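/- arXiv:1207.3906 — 2 statements merged into one kernel-verified Lean document; each statement's English description precedes it below -/
import Mathlib

section
/- Let D, l be positive integers and let (X,T) be an extension of an aperiodic subshift over the alphabet {1,…,l} (a closed shift-invariant subset of {1,…,l}^ℤ with no periodic points). If mdim(X,T) < D/2, then (X,T) embeds equivariantly into (([0,1]^D)^ℤ, σ). -/
open scoped ENNReal NNReal
open Set Function Filter Topology

/-- The `n`-th iterate (`n ∈ ℤ`) of a homeomorphism. -/
noncomputable def hIter {X : Type*} [TopologicalSpace X] (T : X ≃ₜ X) (n : ℤ) (x : X) : X :=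
  if 0 ≤ n then (⇑T)^[n.toNat] x else (⇑T.symm)^[(-n).toNat] x

/-- `WidimLE d ε n`: there is a finite open cover of mesh `< ε` (w.r.t. the distance
function `d`) and of order `≤ n`, i.e. every point lies in at most `n+1` members
(equivalently any `n+2` distinct members have empty intersection). -/
def WidimLE {X : Type*} [TopologicalSpace X] (d : X → X → ℝ) (ε : ℝ) (n : ℕ) : Prop :=
  ∃ (N : ℕ) (U : Fin N → Set X),
    (∀ i, IsOpen (U i)) ∧ (⋃ i, U i) = Set.univ ∧
    (∀ i, ∀ x ∈ U i, ∀ y ∈ U i, d x y < ε) ∧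
    (∀ x : X, ({i | x ∈ U i} : Set (Fin N)).ncard ≤ n + 1)

/-- `widim d ε` : the ε-width dimension with respect to the distance function `d`. -/
noncomputable def widim {X : Type*} [TopologicalSpace X] (d : X → X → ℝ) (ε : ℝ) : ℝ≥0∞ :=
  sInf {c : ℝ≥0∞ | ∃ n : ℕ, c = n ∧ WidimLE d ε n}

/-- `dynDist T n` is the dynamical distance `d_0^{n-1}(x,y) = max_{0 ≤ i < n} d(T^i x, T^i y)`. -/
noncomputable def dynDist {X : Type*} [PseudoMetricSpace X] (T : X → X) (n : ℕ) (x y : X) : ℝ :=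
  (((Finset.range n).sup fun i => nndist (T^[i] x) (T^[i] y)) : ℝ≥0)

/-- Mean dimension `mdim(X,T) = sup_{ε>0} lim_n widim_ε(X, d_0^{n-1})/n`
(the limit exists, so it coincides with the limsup used here). -/
noncomputable def mdim {X : Type*} [MetricSpace X] (T : X → X) : ℝ≥0∞ :=
  ⨆ (ε : ℝ) (_ : 0 < ε), Filter.atTop.limsup fun n : ℕ => widim (dynDist T n) ε / (n : ℝ≥0∞)

/-- The left shift on `ℤ`-indexed sequences. -/
def shift {A : Type*} (x : ℤ → A) : ℤ → A := fun n => x (n + 1)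

open Polynomial in
theorem exists_generalPosition_perturbation {N K : ℕ} (c : Fin N → Fin K → ℝ)
    (hc : ∀ k j, c k j ∈ Icc (0 : ℝ) 1) {δ : ℝ} (hδ : 0 < δ) :
    ∃ v : Fin N → Fin K → ℝ, (∀ k j, v k j ∈ Icc (0 : ℝ) 1) ∧
      (∀ k j, |v k j - c k j| < δ) ∧
      ∀ a : Fin N → ℝ, {k | a k ≠ 0}.ncard ≤ K + 1 → ∑ k, a k = 0 →
        (∀ j, ∑ k, a k * v k j = 0) → a = 0 := by
  classical
  let t : Fin N → ℝ := fun k => (k : ℝ) / N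
  have ht : ∀ k, t k ∈ Icc (0 : ℝ) 1 := fun k =>
    ⟨by positivity, div_le_one_of_le₀ (by exact_mod_cast k.2.le) (by positivity)⟩
  have ht_inj : Injective t := by
    intro k k' h
    have hN : (N : ℝ) ≠ 0 := by have := k.pos; positivity
    have h' : (k : ℝ) = k' := by simpa [t, div_left_inj' hN] using h
    exact Fin.ext (by exact_mod_cast h')
  let c' : Fin N → ℕ → ℝ := fun k j =>
    if j = 0 then 1 else if h : j - 1 < K then c k ⟨j - 1, h⟩ else 0
  let q : Fin N → ℕ → ℝ[X] := fun k j => C (c' k j) + X * C (t k ^ j - c' k j)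
  let P : (Σ r : Fin (K + 2), Fin r ↪ Fin N) → ℝ[X] := fun e =>
    (Matrix.of fun i j : Fin e.1 => q (e.2 i) j).det
  have heval : ∀ e s, (P e).eval s =
      (Matrix.of fun i j : Fin e.1 => (q (e.2 i) j).eval s).det := by
    intro e s
    rw [← coe_evalRingHom, RingHom.map_det]
    rfl
  have hP : ∏ e, P e ≠ 0 := by
    refine Finset.prod_ne_zero_iff.2 fun e _ h => ?_
    have h1 := heval e 1
    rw [h, eval_zero] at h1
    have h2 : (Matrix.of fun i j : Fin e.1 => (q (e.2 i) j).eval 1) =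
        Matrix.vandermonde (t ∘ e.2) := by
      ext i j
      simp [q, Matrix.vandermonde]
    rw [h2] at h1
    exact Matrix.det_vandermonde_ne_zero_iff.2 (ht_inj.comp e.2.injective) h1.symm
  obtain ⟨s, ⟨hs0, hs1⟩, hs⟩ :=
    (Ioo_infinite (show (0 : ℝ) < min δ 1 by positivity)).exists_notMem_finset
      (∏ e, P e).roots.toFinset
  have hs' : ∀ e, (P e).eval s ≠ 0 := by
    intro e he
    refine hs ?_
    rw [Multiset.mem_toFinset, mem_roots hP, IsRoot.def, eval_prod]
    exact Finset.prod_eq_zero (Finset.mem_univ e) he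
  have hsδ := hs1.trans_le (min_le_left _ _)
  have hs1' := hs1.trans_le (min_le_right _ _)
  refine ⟨fun k j => c k j + s * (t k ^ (j.1 + 1) - c k j), fun k j => ?_, fun k j => ?_, ?_⟩
  · have h1 := pow_le_one₀ (n := j.1 + 1) (ht k).1 (ht k).2
    have h0 := pow_nonneg (ht k).1 (j.1 + 1)
    obtain ⟨h2, h3⟩ := hc k j
    constructor <;> nlinarith
  · have h1 := pow_le_one₀ (n := j.1 + 1) (ht k).1 (ht k).2
    have h0 := pow_nonneg (ht k).1 (j.1 + 1)
    obtain ⟨h2, h3⟩ := hc k j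
    rw [add_sub_cancel_left, abs_mul, abs_of_pos hs0]
    have : |t k ^ (j.1 + 1) - c k j| ≤ 1 := abs_le.2 ⟨by linarith, by linarith⟩
    nlinarith
  · intro a ha hsum hv
    let S : Finset (Fin N) := {k | a k ≠ 0}
    have hS : S.card < K + 2 := by
      have : ({k | a k ≠ 0} : Set (Fin N)) = S := by ext; simp [S]
      rw [this, Set.ncard_coe_finset] at ha
      omega
    let e : Fin S.card ↪ Fin N := (S.orderEmbOfFin rfl).toEmbedding
    have hsumS : ∀ g : Fin N → ℝ, ∑ i, a (e i) * g (e i) = ∑ k, a k * g k := by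
      intro g
      have h1 : ∑ k ∈ S, a k * g k = ∑ k, a k * g k := by
        refine Finset.sum_subset (Finset.subset_univ _) fun k _ hk => ?_
        have : a k = 0 := by simpa [S] using hk
        simp [this]
      rw [← h1, ← Finset.sum_map Finset.univ e (fun k => a k * g k)]
      congr 1
      exact Finset.map_orderEmbOfFin_univ S rfl
    have hdet := hs' ⟨⟨S.card, hS⟩, e⟩
    rw [heval] at hdet
    have hvec := Matrix.eq_zero_of_vecMul_eq_zero (v := fun i => a (e i)) hdet (by
      ext j
      have : ∑ i, a (e i) * (q (e i) j).eval s = 0 := by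
        rw [hsumS fun k => (q k j).eval s]
        rcases j with ⟨_ | j, hj⟩
        · simpa [q, c'] using hsum
        · have hjK : j < K := by simp only at hj; omega
          simpa [q, c', hjK] using hv ⟨j, hjK⟩
      simpa [Matrix.vecMul, dotProduct] using this)
    ext k
    by_contra hk
    have hkS : k ∈ S := by simpa [S] using hk
    rw [← Finset.map_orderEmbOfFin_univ S rfl] at hkS
    obtain ⟨i, -, rfl⟩ := Finset.mem_map.1 hkS
    exact hk (congrFun hvec i)

theorem WidimLE.exists_perturbation_almost_injective {X : Type*} [TopologicalSpace X]
    [CompactSpace X] [T2Space X] {d : X → X → ℝ} {ε δ : ℝ} {m K : ℕ} (h : WidimLE d ε m)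
    (hmK : 2 * m + 1 ≤ K) (hδ : 0 < δ) (f : X → Fin K → ℝ)
    (hf01 : ∀ x j, f x j ∈ Icc (0 : ℝ) 1)
    (hfδ : ∀ x y, d x y < ε → ∀ j, |f x j - f y j| < δ) :
    ∃ F : X → Fin K → ℝ, Continuous F ∧ (∀ x j, F x j ∈ Icc (0 : ℝ) 1) ∧
      (∀ x j, |F x j - f x j| ≤ 2 * δ) ∧ ∀ x y, F x = F y → d x y < ε := by
  classical
  obtain ⟨N, U, hUo, hUc, hUd, hUm⟩ := h
  rcases isEmpty_or_nonempty X with hX | hX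
  · exact ⟨f, continuous_of_const fun x => hX.elim x, hf01, fun x => hX.elim x,
      fun x => hX.elim x⟩
  obtain ⟨ψ, hψ⟩ := PartitionOfUnity.exists_isSubordinate_of_locallyFinite isClosed_univ U hUo
    (locallyFinite_of_finite U) hUc.ge
  have hψU : ∀ k x, ψ k x ≠ 0 → x ∈ U k := fun k x hx => hψ k (subset_tsupport _ hx)
  have hψ1 : ∀ x, ∑ k, ψ k x = 1 := fun x => by
    rw [← finsum_eq_sum_of_fintype]; exact ψ.sum_eq_one (mem_univ x)
  let p : Fin N → X := fun k => if hk : (U k).Nonempty then hk.some else Classical.arbitrary X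
  have hp : ∀ k x, x ∈ U k → p k ∈ U k := fun k x hx => by
    have hk : (U k).Nonempty := ⟨x, hx⟩
    simp only [p, dif_pos hk]
    exact hk.some_mem
  obtain ⟨v, hv01, hvδ, hv⟩ := exists_generalPosition_perturbation (fun k => f (p k))
    (fun k => hf01 (p k)) hδ
  refine ⟨fun x j => ∑ k, ψ k x * v k j, by fun_prop, fun x j => ⟨?_, ?_⟩, fun x j => ?_,
    fun x y hxy => ?_⟩
  · exact Finset.sum_nonneg fun k _ => mul_nonneg (ψ.nonneg k x) (hv01 k j).1
  · rw [← hψ1 x]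
    exact Finset.sum_le_sum fun k _ => mul_le_of_le_one_right (ψ.nonneg k x) (hv01 k j).2
  · have h1 : ∑ k, ψ k x * v k j - f x j = ∑ k, ψ k x * (v k j - f x j) := by
      simp only [mul_sub, Finset.sum_sub_distrib, ← Finset.sum_mul, hψ1, one_mul]
    have h2 : 2 * δ = ∑ k, ψ k x * (2 * δ) := by rw [← Finset.sum_mul, hψ1, one_mul]
    rw [h1, h2]
    refine (Finset.abs_sum_le_sum_abs _ _).trans (Finset.sum_le_sum fun k _ => ?_)
    rw [abs_mul, abs_of_nonneg (ψ.nonneg k x)]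
    by_cases hk : ψ k x = 0
    · simp [hk]
    · refine mul_le_mul_of_nonneg_left ?_ (ψ.nonneg k x)
      have hxU := hψU k x hk
      have h3 := hvδ k j
      have h4 := hfδ _ _ (hUd k _ (hp k x hxU) x hxU) j
      linarith [abs_sub_le (v k j) (f (p k) j) (f x j)]
  · have hz : (fun k => ψ k x - ψ k y) = 0 := by
      refine hv _ ?_ ?_ fun j => ?_
      · have hsub : {k | ψ k x - ψ k y ≠ 0} ⊆ {k | x ∈ U k} ∪ {k | y ∈ U k} := by
          intro k hk
          by_contra hcon
          simp only [mem_union, mem_ofPred_eq, not_or] at hcon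
          have hx0 : ψ k x = 0 := by by_contra h0; exact hcon.1 (hψU k x h0)
          have hy0 : ψ k y = 0 := by by_contra h0; exact hcon.2 (hψU k y h0)
          exact hk (by rw [hx0, hy0, sub_zero])
        have h1 := Set.ncard_le_ncard hsub (Set.toFinite _)
        have h2 := Set.ncard_union_le {k | x ∈ U k} {k | y ∈ U k}
        have h3 := hUm x
        have h4 := hUm y
        omega
      · rw [Finset.sum_sub_distrib, hψ1, hψ1, sub_self]
      · simp only [sub_mul, Finset.sum_sub_distrib]
        exact sub_eq_zero.2 (congrFun hxy j)
    obtain ⟨k, -, hk⟩ := Finset.exists_ne_zero_of_sum_ne_zero (by rw [hψ1 x]; exact one_ne_zero)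
    have hky : ψ k y ≠ 0 := by
      have := sub_eq_zero.1 (congrFun hz k)
      rwa [← this]
    exact hUd k x (hψU k x hk) y (hψU k y hky)

theorem dist_iterate_le_dynDist {X : Type*} [PseudoMetricSpace X] (T : X → X) {n j : ℕ}
    (hj : j < n) (x y : X) : dist (T^[j] x) (T^[j] y) ≤ dynDist T n x y := by
  rw [dist_nndist, dynDist, NNReal.coe_le_coe]
  exact Finset.le_sup (f := fun i => nndist (T^[i] x) (T^[i] y)) (Finset.mem_range.2 hj)

theorem eventually_exists_widimLE_dynDist {X : Type*} [MetricSpace X] {T : X → X} {D : ℕ}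
    (h : mdim T < (D : ℝ≥0∞) / 2) {ε : ℝ} (hε : 0 < ε) :
    ∃ N : ℕ, ∀ n ≥ N, ∃ m : ℕ, WidimLE (dynDist T n) ε m ∧ 2 * m + 1 ≤ n * D := by
  have h1 : limsup (fun n : ℕ => widim (dynDist T n) ε / (n : ℝ≥0∞)) atTop < (D : ℝ≥0∞) / 2 :=
    (le_iSup₂ (f := fun (ε : ℝ) (_ : 0 < ε) =>
      atTop.limsup fun n : ℕ => widim (dynDist T n) ε / (n : ℝ≥0∞)) ε hε).trans_lt h
  obtain ⟨N, hN⟩ := eventually_atTop.1 (eventually_lt_of_limsup_lt h1)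
  refine ⟨max N 1, fun n hn => ?_⟩
  have hn1 : 1 ≤ n := (le_max_right _ _).trans hn
  have h2 := hN n ((le_max_left _ _).trans hn)
  have hn0 : (n : ℝ≥0∞) ≠ 0 := by exact_mod_cast (by omega : n ≠ 0)
  rw [ENNReal.div_lt_iff (Or.inl hn0) (Or.inl (ENNReal.natCast_ne_top n))] at h2
  obtain ⟨c, ⟨m, rfl, hm⟩, hlt⟩ := sInf_lt_iff.1 h2
  refine ⟨m, hm, ?_⟩
  have h3 : (m : ℝ≥0∞) * 2 < n * D := by
    have h4 := ENNReal.mul_lt_mul_left two_ne_zero ENNReal.ofNat_ne_top hlt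
    have h5 : (D : ℝ≥0∞) / 2 * n * 2 = n * D := by
      rw [mul_right_comm, ENNReal.div_mul_cancel (by norm_num) (by norm_num), mul_comm]
    rwa [h5] at h4
  have h6 : m * 2 < n * D := by exact_mod_cast h3
  omega

theorem exists_block_maps {X : Type*} [MetricSpace X] [CompactSpace X] (T : X → X)
    {n m D : ℕ} {ε δ : ℝ} (h : WidimLE (dynDist T n) ε m) (hm : 2 * m + 1 ≤ n * D)
    (hδ : 0 < δ) (f : X → Fin D → ℝ) (hf01 : ∀ x i, f x i ∈ Icc (0 : ℝ) 1)
    (hfδ : ∀ x y, dist x y < ε → ∀ i, |f x i - f y i| < δ) :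
    ∃ F : ℕ → X → Fin D → ℝ, (∀ j, Continuous (F j)) ∧ (∀ j x i, F j x i ∈ Icc (0 : ℝ) 1) ∧
      (∀ j < n, ∀ x i, |F j x i - f (T^[j] x) i| ≤ 2 * δ) ∧
      ∀ x y, (∀ j < n, F j x = F j y) → dynDist T n x y < ε := by
  obtain ⟨G, hGc, hG01, hGf, hGi⟩ := h.exists_perturbation_almost_injective hm hδ
    (fun x k => f (T^[(finProdFinEquiv.symm k).1] x) (finProdFinEquiv.symm k).2)
    (fun x k => hf01 _ _)
    (fun x y hxy k => hfδ _ _ ((dist_iterate_le_dynDist T (Fin.is_lt _) x y).trans_lt hxy) _)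
  refine ⟨fun j x i => if hj : j < n then G x (finProdFinEquiv (⟨j, hj⟩, i)) else 0,
    fun j => ?_, fun j x i => ?_, fun j hj x i => ?_, fun x y hxy => hGi x y ?_⟩
  · by_cases hj : j < n
    · simp only [hj, dif_pos]
      fun_prop
    · simp only [hj, dif_neg, not_false_eq_true]
      exact continuous_const
  · by_cases hj : j < n
    · simpa only [hj, dif_pos] using hG01 x _
    · simp [hj]
  · simpa [hj] using hGf x (finProdFinEquiv (⟨j, hj⟩, i))
  · ext k
    obtain ⟨⟨j, i⟩, rfl⟩ := finProdFinEquiv.surjective k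
    simpa using congrFun (hxy j j.2) i

theorem Homeomorph.iterate_eq_zpow {X : Type*} [TopologicalSpace X] (T : X ≃ₜ X) (n : ℕ) (x : X) :
    T^[n] x = (T ^ (n : ℤ)) x := by
  induction n generalizing x with
  | zero => rfl
  | succ n ih =>
    rw [iterate_succ_apply, ih, Nat.cast_succ, zpow_add_one, Homeomorph.mul_apply]

theorem Homeomorph.zpow_zpow_apply {X : Type*} [TopologicalSpace X] (T : X ≃ₜ X) (m n : ℤ)
    (x : X) : (T ^ m) ((T ^ n) x) = (T ^ (m + n)) x := by
  rw [zpow_add, Homeomorph.mul_apply]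

theorem Homeomorph.map_zpow_of_semiconj {X Y : Type*} [TopologicalSpace X] [TopologicalSpace Y]
    {T : X ≃ₜ X} {S : Y ≃ₜ Y} {π : X → Y} (h : ∀ x, π (T x) = S (π x)) (n : ℤ) (x : X) :
    π ((T ^ n) x) = (S ^ n) (π x) := by
  induction n with
  | zero => rfl
  | succ n ih =>
    rw [add_comm, zpow_one_add, zpow_one_add, Homeomorph.mul_apply, Homeomorph.mul_apply, h, ih]
  | pred n ih =>
    apply S.injective
    rw [← h, ← Homeomorph.mul_apply, ← Homeomorph.mul_apply, ← zpow_one_add, ← zpow_one_add]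
    simpa using ih

theorem exists_isClopen_marker {A : Type*} [TopologicalSpace A] [TotallySeparatedSpace A]
    (S : A ≃ₜ A) {Z : Set A} (hZ : IsCompact Z)
    (hap : ∀ z ∈ Z, ∀ n : ℕ, 0 < n → (S ^ (n : ℤ)) z ≠ z) (N : ℕ) :
    ∃ U : Set A, IsClopen U ∧ (∀ z ∈ U, ∀ n : ℕ, 0 < n → n < N → (S ^ (n : ℤ)) z ∉ U) ∧
      ∀ z ∈ Z, ∃ n : ℤ, |n| ≤ N ∧ (S ^ n) z ∈ U := by
  classical
  have hV : ∀ z ∈ Z, ∃ V : Set A, IsClopen V ∧ z ∈ V ∧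
      ∀ w ∈ V, ∀ n : ℕ, 0 < n → n < N → (S ^ (n : ℤ)) w ∉ V := by
    intro z hz
    have h1 : ∀ n : ℕ, ∃ C : Set A, IsClopen C ∧ (0 < n → z ∈ C ∧ (S ^ (n : ℤ)) z ∉ C) := by
      intro n
      rcases Nat.eq_zero_or_pos n with rfl | hn
      · exact ⟨univ, isClopen_univ, fun h => absurd h (lt_irrefl _)⟩
      · obtain ⟨C, hC, hz1, hz2⟩ := exists_isClopen_of_totally_separated (hap z hz n hn).symm
        exact ⟨C, hC, fun _ => ⟨hz1, hz2⟩⟩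
    choose C hC hzC using h1
    refine ⟨⋂ n ∈ Finset.Ioo 0 N, C n \ (S ^ (n : ℤ)) ⁻¹' C n,
      isClopen_biInter_finset fun n _ => (hC n).diff ((hC n).preimage (S ^ (n : ℤ)).continuous),
      ?_, fun w hw n hn hnN hw' => ?_⟩
    · simp only [mem_iInter, Finset.mem_Ioo]
      exact fun n hn => hzC n hn.1
    · simp only [mem_iInter, Finset.mem_Ioo] at hw hw'
      exact (hw n ⟨hn, hnN⟩).2 (hw' n ⟨hn, hnN⟩).1
  choose! V hVc hzV hVs using hV
  obtain ⟨t, ht⟩ := hZ.elim_finite_subcover (fun z : Z => V z) (fun z => (hVc z z.2).isOpen)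
    fun z hz => mem_iUnion.2 ⟨⟨z, hz⟩, hzV z hz⟩
  have key : ∀ t : Finset Z, ∃ U : Set A, IsClopen U ∧
      (∀ z ∈ U, ∀ n : ℕ, 0 < n → n < N → (S ^ (n : ℤ)) z ∉ U) ∧
      ∀ z ∈ t, ∀ w ∈ V z, ∃ n : ℤ, |n| ≤ N ∧ (S ^ n) w ∈ U := by
    intro t
    induction t using Finset.induction_on with
    | empty => exact ⟨∅, isClopen_empty, by simp, by simp⟩
    | insert a t _ ih =>
      obtain ⟨U, hU, hUs, hUt⟩ := ih
      let B : Set A := ⋃ n ∈ Finset.Icc (-(N : ℤ)) N, (S ^ n) ⁻¹' U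
      have hB : ∀ w, w ∈ B ↔ ∃ n : ℤ, |n| ≤ N ∧ (S ^ n) w ∈ U := by
        intro w
        simp [B, abs_le, and_assoc]
      have hBc : IsClopen B :=
        isClopen_biUnion_finset fun n _ => hU.preimage (S ^ n).continuous
      refine ⟨U ∪ V a \ B, hU.union ((hVc a a.2).diff hBc), ?_, fun z hz w hw => ?_⟩
      · rintro z (hz | hz) n hn hnN (hz' | hz')
        · exact hUs z hz n hn hnN hz'
        · refine hz'.2 ((hB _).2 ⟨-n, ?_, ?_⟩)
          · rw [abs_neg, Nat.abs_cast]
            exact_mod_cast hnN.le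
          · rw [Homeomorph.zpow_zpow_apply, neg_add_cancel]
            exact hz
        · refine hz.2 ((hB _).2 ⟨n, ?_, hz'⟩)
          rw [Nat.abs_cast]
          exact_mod_cast hnN.le
        · exact hVs a a.2 z hz.1 n hn hnN hz'.1
      · by_cases hwB : w ∈ B
        · obtain ⟨n, hn, hnU⟩ := (hB w).1 hwB
          exact ⟨n, hn, Or.inl hnU⟩
        · rcases Finset.mem_insert.1 hz with rfl | hz
          · exact ⟨0, by simp, Or.inr ⟨hw, hwB⟩⟩
          · exact absurd ((hB w).2 (hUt z hz w hw)) hwB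
  obtain ⟨U, hU, hUs, hUt⟩ := key t
  refine ⟨U, hU, hUs, fun z hz => ?_⟩
  obtain ⟨a, ha, hza⟩ := mem_iUnion₂.1 (ht hz)
  exact hUt a ha z hza

theorem isOpen_setOf_natFind_eq {X : Type*} [TopologicalSpace X] {E : ℕ → Set X}
    (hE : ∀ k, IsClopen (E k)) [∀ x, DecidablePred fun k => x ∈ E k] (h : ∀ x, ∃ k, x ∈ E k)
    (k : ℕ) : IsOpen {x | Nat.find (h x) = k} := by
  have : {x | Nat.find (h x) = k} = E k ∩ ⋂ j ∈ Finset.range k, (E j)ᶜ := by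
    ext x
    simp [Nat.find_eq_iff]
  rw [this]
  exact (hE k).isOpen.inter (isOpen_biInter_finset fun j _ => (hE j).compl.isOpen)

theorem exists_perturbation_of_marker {X : Type*} [MetricSpace X] [CompactSpace X] (T : X ≃ₜ X)
    {D N : ℕ} {ε δ : ℝ}
    (hw : ∀ n ≥ N, ∃ m : ℕ, WidimLE (dynDist T n) ε m ∧ 2 * m + 1 ≤ n * D)
    {E : Set X} (hE : IsClopen E)
    (hEs : ∀ x ∈ E, ∀ n : ℕ, 0 < n → n < N → (T ^ (n : ℤ)) x ∉ E)
    (hEc : ∀ x, ∃ n : ℤ, |n| ≤ N ∧ (T ^ n) x ∈ E)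
    (hδ : 0 < δ) (f : X → Fin D → ℝ) (hf01 : ∀ x i, f x i ∈ Icc (0 : ℝ) 1)
    (hfδ : ∀ x y, dist x y < ε → ∀ i, |f x i - f y i| < δ) :
    ∃ g : X → Fin D → ℝ, Continuous g ∧ (∀ x i, g x i ∈ Icc (0 : ℝ) 1) ∧
      (∀ x i, |g x i - f x i| ≤ 2 * δ) ∧
      ∀ x y, (∀ n : ℤ, (T ^ n) x ∈ E ↔ (T ^ n) y ∈ E) →
        (∀ n : ℤ, g ((T ^ n) x) = g ((T ^ n) y)) → dist x y < ε := by
  classical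
  have hF : ∀ n, ∃ F : ℕ → X → Fin D → ℝ, N ≤ n → (∀ j, Continuous (F j)) ∧
      (∀ j x i, F j x i ∈ Icc (0 : ℝ) 1) ∧
      (∀ j < n, ∀ x i, |F j x i - f (T^[j] x) i| ≤ 2 * δ) ∧
      ∀ x y, (∀ j < n, F j x = F j y) → dynDist T n x y < ε := by
    intro n
    by_cases hn : N ≤ n
    · obtain ⟨m, hm, hmn⟩ := hw n hn
      obtain ⟨F, hF⟩ := exists_block_maps T hm hmn hδ f hf01 hfδ
      exact ⟨F, fun _ => hF⟩
    · exact ⟨0, fun h => absurd h hn⟩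
  choose F hF using hF
  have hp : ∀ x, ∃ k : ℕ, (T ^ (-(k : ℤ))) x ∈ E := by
    intro x
    obtain ⟨n, hn, hnE⟩ := hEc ((T ^ (-(N : ℤ))) x)
    rw [Homeomorph.zpow_zpow_apply] at hnE
    refine ⟨(N - n).toNat, ?_⟩
    rwa [Int.toNat_of_nonneg (by linarith [(abs_le.1 hn).2]), neg_sub, sub_eq_add_neg]
  have hq : ∀ x, ∃ k : ℕ, (T ^ (k + 1 : ℤ)) x ∈ E := by
    intro x
    obtain ⟨n, hn, hnE⟩ := hEc ((T ^ (N + 1 : ℤ)) x)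
    rw [Homeomorph.zpow_zpow_apply] at hnE
    refine ⟨(n + N).toNat, ?_⟩
    rwa [Int.toNat_of_nonneg (by linarith [(abs_le.1 hn).1]), add_assoc]
  -- `p x` and `q x + 1` are the distances from `x` to the previous and to the next visit to `E`.
  let p : X → ℕ := fun x => Nat.find (hp x)
  let q : X → ℕ := fun x => Nat.find (hq x)
  have hpE : ∀ x, (T ^ (-(p x : ℤ))) x ∈ E := fun x => Nat.find_spec (hp x)
  have hqE : ∀ x, (T ^ (q x + 1 : ℤ)) x ∈ E := fun x => Nat.find_spec (hq x)
  have hpq : ∀ x, ∀ e : ℤ, -(p x : ℤ) < e → e ≤ q x → (T ^ e) x ∉ E := by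
    intro x e he1 he2
    rcases le_or_gt e 0 with he | he
    · have := Nat.find_min (hp x) (m := (-e).toNat) (by change _ < p x; omega)
      rwa [Int.toNat_of_nonneg (by omega), neg_neg] at this
    · have := Nat.find_min (hq x) (m := (e - 1).toNat) (by change _ < q x; omega)
      rwa [Int.toNat_of_nonneg (by omega), sub_add_cancel] at this
  have hN : ∀ x, N ≤ p x + q x + 1 := by
    intro x
    by_contra! hlt
    refine hEs _ (hpE x) (p x + q x + 1) (by omega) hlt ?_
    rw [Homeomorph.zpow_zpow_apply]
    convert hqE x using 3
    push_cast
    ring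
  have hpo : ∀ k, IsOpen {x | p x = k} := fun k => isOpen_setOf_natFind_eq
    (E := fun k : ℕ => (T ^ (-(k : ℤ))) ⁻¹' E)
    (fun k => hE.preimage (T ^ (-(k : ℤ))).continuous) hp k
  have hqo : ∀ k, IsOpen {x | q x = k} := fun k => isOpen_setOf_natFind_eq
    (E := fun k : ℕ => (T ^ (k + 1 : ℤ)) ⁻¹' E)
    (fun k => hE.preimage (T ^ (k + 1 : ℤ)).continuous) hq k
  let g : X → Fin D → ℝ := fun x => F (p x + q x + 1) (p x) ((T ^ (-(p x : ℤ))) x)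
  have hg : ∀ x, ∀ j < p x + q x + 1,
      g ((T ^ (j - p x : ℤ)) x) = F (p x + q x + 1) j ((T ^ (-(p x : ℤ))) x) := by
    intro x j hj
    have h1 : p ((T ^ (j - p x : ℤ)) x) = j := by
      refine (Nat.find_eq_iff _).2 ⟨?_, fun i hi => ?_⟩
      · rw [Homeomorph.zpow_zpow_apply]
        convert hpE x using 3
        ring
      · rw [Homeomorph.zpow_zpow_apply]
        exact hpq x _ (by omega) (by omega)
    have h2 : q ((T ^ (j - p x : ℤ)) x) = p x + q x - j := by
      refine (Nat.find_eq_iff _).2 ⟨?_, fun i hi => ?_⟩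
      · rw [Homeomorph.zpow_zpow_apply]
        convert hqE x using 3
        omega
      · rw [Homeomorph.zpow_zpow_apply]
        exact hpq x _ (by omega) (by omega)
    simp only [g, h1, h2, Homeomorph.zpow_zpow_apply]
    congr 2
    · omega
    · congr 1
      ring_nf
  refine ⟨g, ?_, fun x i => (hF _ (hN x)).2.1 _ _ _, fun x i => ?_, fun x y hxy hgxy => ?_⟩
  · rw [continuous_iff_continuousAt]
    intro x
    have hcont : Continuous fun y => F (p x + q x + 1) (p x) ((T ^ (-(p x : ℤ))) y) :=
      ((hF _ (hN x)).1 _).comp (T ^ (-(p x : ℤ))).continuous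
    refine hcont.continuousAt.congr ?_
    filter_upwards [(hpo (p x)).mem_nhds rfl, (hqo (q x)).mem_nhds rfl] with y hy1 hy2
    replace hy1 : p y = p x := hy1
    replace hy2 : q y = q x := hy2
    simp only [g, hy1, hy2]
  · have := (hF _ (hN x)).2.2.1 (p x) (by omega) ((T ^ (-(p x : ℤ))) x) i
    rwa [Homeomorph.iterate_eq_zpow, Homeomorph.zpow_zpow_apply, add_neg_cancel] at this
  · have hpxy : p x = p y := by
      simp only [p, hxy]
    have hqxy : q x = q y := by
      simp only [q, hxy]
    have h1 := (hF _ (hN x)).2.2.2 ((T ^ (-(p x : ℤ))) x) ((T ^ (-(p x : ℤ))) y) fun j hj => by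
      rw [← hg x j hj, hgxy, hpxy, hg y j (by omega), hqxy]
    have h2 := dist_iterate_le_dynDist T (show p x < p x + q x + 1 by omega)
      ((T ^ (-(p x : ℤ))) x) ((T ^ (-(p x : ℤ))) y)
    simp only [Homeomorph.iterate_eq_zpow, Homeomorph.zpow_zpow_apply, add_neg_cancel] at h2
    exact h2.trans_lt h1

theorem exists_continuousMap_orbit_separating {X A : Type*} [MetricSpace X] [CompactSpace X]
    [TopologicalSpace A] [T2Space A] (T : X ≃ₜ X) {π : X → A} (hπ : Continuous π) {D : ℕ}
    (h : ∀ ε > 0, ∀ δ > 0, ∀ f : C(X, Fin D → unitInterval), ∃ g : C(X, Fin D → unitInterval),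
      dist g f ≤ δ ∧ ∀ x y, π x = π y → (∀ n : ℤ, g ((T ^ n) x) = g ((T ^ n) y)) →
        dist x y < ε) :
    ∃ f : C(X, Fin D → unitInterval),
      ∀ x y, π x = π y → (∀ n : ℤ, f ((T ^ n) x) = f ((T ^ n) y)) → x = y := by
  let O : ℕ → Set C(X, Fin D → unitInterval) := fun k =>
    {f | ∀ x y, π x = π y → (∀ n : ℤ, f ((T ^ n) x) = f ((T ^ n) y)) → dist x y < 1 / (k + 1 : ℝ)}
  have hO : ∀ k, IsOpen (O k) := by
    intro k
    let W : Set ((X × X) × C(X, Fin D → unitInterval)) :=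
      {p | 1 / (k + 1 : ℝ) ≤ dist p.1.1 p.1.2} ∩ ({p | π p.1.1 = π p.1.2} ∩
        ⋂ n : ℤ, {p | p.2 ((T ^ n) p.1.1) = p.2 ((T ^ n) p.1.2)})
    have hW : IsClosed W := by
      refine (isClosed_le continuous_const (by fun_prop)).inter
        ((isClosed_eq (by fun_prop) (by fun_prop)).inter (isClosed_iInter fun n => ?_))
      have hT : Continuous (T ^ n) := (T ^ n).continuous
      exact isClosed_eq (by fun_prop) (by fun_prop)
    have hOW : O k = (Prod.snd '' W)ᶜ := by
      ext f
      simp only [O, W, mem_compl_iff, mem_image, Prod.exists, mem_inter_iff, mem_iInter,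
        mem_ofPred_eq, not_exists]
      constructor
      · rintro hf x y g ⟨⟨h1, h2, h3⟩, rfl⟩
        exact absurd (hf x y h2 h3) (not_lt.2 h1)
      · intro hf x y h2 h3
        by_contra! h1
        exact hf x y f ⟨⟨h1, h2, h3⟩, rfl⟩
    rw [hOW]
    exact (isClosedMap_snd_of_compactSpace W hW).isOpen_compl
  have hOd : ∀ k, Dense (O k) := by
    intro k
    refine Metric.dense_iff.2 fun f r hr => ?_
    obtain ⟨g, hg, hgs⟩ := h (1 / (k + 1 : ℝ)) (by positivity) (r / 2) (by positivity) f
    exact ⟨g, Metric.mem_ball.2 (by linarith), hgs⟩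
  obtain ⟨f, hf⟩ := (dense_iInter_of_isOpen_nat hO hOd).nonempty
  refine ⟨f, fun x y hxy hn => ?_⟩
  by_contra hne
  obtain ⟨k, hk⟩ := exists_nat_one_div_lt (dist_pos.2 hne)
  exact lt_asymm hk (mem_iInter.1 hf k x y hxy hn)

/-- The left shift as a homeomorphism. -/
def shiftHomeomorph (A : Type*) [TopologicalSpace A] : (ℤ → A) ≃ₜ (ℤ → A) where
  toFun := shift
  invFun x n := x (n - 1)
  left_inv x := by ext n; simp [shift]
  right_inv x := by ext n; simp [shift]
  continuous_toFun := continuous_pi fun n => continuous_apply (n + 1)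
  continuous_invFun := continuous_pi fun n => continuous_apply (n - 1)

theorem shiftHomeomorph_zpow_apply {A : Type*} [TopologicalSpace A] (n : ℤ) (x : ℤ → A) (k : ℤ) :
    (shiftHomeomorph A ^ n) x k = x (k + n) := by
  induction n generalizing x k with
  | zero => simp
  | succ n ih =>
    rw [zpow_add_one, Homeomorph.mul_apply, ih]
    exact congrArg x (add_assoc _ _ _)
  | pred n ih =>
    rw [zpow_sub_one, Homeomorph.mul_apply, ih]
    exact congrArg x (by ring : k + -(n : ℤ) - 1 = k + (-n - 1))

theorem exists_equivariant_embedding_of_orbit_separating {X : Type*} [TopologicalSpace X]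
    [CompactSpace X] (T : X ≃ₜ X) {D l : ℕ} (hD : 0 < D) (hl : 0 < l) {π : X → ℤ → Fin l}
    (hπc : Continuous π) (hπe : ∀ x, π (T x) = shift (π x)) (f : C(X, Fin D → unitInterval))
    (hf : ∀ x y, π x = π y → (∀ n : ℤ, f ((T ^ n) x) = f ((T ^ n) y)) → x = y) :
    ∃ φ : X → ℤ → Fin D → ℝ, Topology.IsEmbedding φ ∧
      (∀ x n i, φ x n i ∈ Set.Icc (0:ℝ) 1) ∧ (∀ x, φ (T x) = shift (φ x)) := by
  let s : X → ℕ := fun x => π x 0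
  have hsc : Continuous s :=
    continuous_of_discreteTopology.comp ((continuous_apply 0).comp hπc)
  have hl0 : (0 : ℝ) < l := by exact_mod_cast hl
  let H : X → Fin D → ℝ := fun x i =>
    if i = ⟨0, hD⟩ then ((s x : ℝ) + (f x i : ℝ) / 2) / l else f x i
  have hHc : Continuous H := by
    refine continuous_pi fun i => ?_
    by_cases hi : i = ⟨0, hD⟩
    · simp only [H, hi, if_true]
      have : Continuous fun x => (s x : ℝ) := continuous_of_discreteTopology.comp hsc
      fun_prop
    · simp only [H, hi, if_false]
      fun_prop
  have hH01 : ∀ x i, H x i ∈ Icc (0 : ℝ) 1 := by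
    intro x i
    by_cases hi : i = ⟨0, hD⟩
    · simp only [H, hi, if_true]
      have h0 := (f x ⟨0, hD⟩).2.1
      have h1 := (f x ⟨0, hD⟩).2.2
      have h2 : (s x : ℝ) + 1 ≤ l := by exact_mod_cast (π x 0).2
      refine ⟨by positivity, (div_le_one hl0).2 (by linarith)⟩
    · simp only [H, hi, if_false]
      exact (f x i).2
  have hHinj : ∀ x y, H x = H y → π x 0 = π y 0 ∧ f x = f y := by
    intro x y hxy
    have h0 : (s x : ℝ) + (f x ⟨0, hD⟩ : ℝ) / 2 = s y + (f y ⟨0, hD⟩ : ℝ) / 2 := by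
      simpa [H, div_left_inj' hl0.ne'] using congrFun hxy ⟨0, hD⟩
    have hs : s x = s y := by
      have h1 := (f x ⟨0, hD⟩).2
      have h2 := (f y ⟨0, hD⟩).2
      have h3 : (s x : ℝ) < s y + 1 := by linarith [h1.1, h2.2]
      have h4 : (s y : ℝ) < s x + 1 := by linarith [h2.1, h1.2]
      have h5 : s x < s y + 1 := by exact_mod_cast h3
      have h6 : s y < s x + 1 := by exact_mod_cast h4
      omega
    refine ⟨Fin.ext hs, ?_⟩
    ext i
    by_cases hi : i = ⟨0, hD⟩
    · rw [hi]
      rw [hs] at h0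
      linarith
    · simpa [H, hi] using congrFun hxy i
  have hπ0 : ∀ x n, π ((T ^ n) x) 0 = π x n := by
    intro x n
    rw [Homeomorph.map_zpow_of_semiconj (S := shiftHomeomorph (Fin l)) hπe,
      shiftHomeomorph_zpow_apply, zero_add]
  refine ⟨fun x n => H ((T ^ n) x), ?_, fun x n i => hH01 _ i, fun x => ?_⟩
  · refine (Continuous.isClosedEmbedding
      (continuous_pi fun n => hHc.comp (T ^ n).continuous) fun x y hxy => ?_).isEmbedding
    have h := fun n => hHinj _ _ (congrFun hxy n)
    refine hf x y (funext fun n => ?_) fun n => (h n).2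
    rw [← hπ0 x n, ← hπ0 y n]
    exact (h n).1
  · ext n : 1
    simp only [shift]
    rw [zpow_add_one, Homeomorph.mul_apply]

/-- Sharp embedding theorem: if `(X,T)` is an extension of an aperiodic subshift
`Z ⊆ {1,…,l}^ℤ` and `mdim(X,T) < D/2`, then `(X,T)` embeds equivariantly into the
shift on `([0,1]^D)^ℤ`. -/
theorem stmt11 {X : Type*} [MetricSpace X] [CompactSpace X] (T : X ≃ₜ X)
    (D l : ℕ) (hD : 0 < D) (hl : 0 < l)
    (Z : Set (ℤ → Fin l)) (hZc : IsClosed Z) (hZinv : shift '' Z = Z)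
    (hZap : ∀ x ∈ Z, ∀ n : ℕ, 0 < n → shift^[n] x ≠ x)
    (π : X → ℤ → Fin l) (hπc : Continuous π) (hπr : Set.range π = Z)
    (hπe : ∀ x, π (T x) = shift (π x))
    (hmdim : mdim ⇑T < (D : ℝ≥0∞) / 2) :
    ∃ φ : X → ℤ → Fin D → ℝ, Topology.IsEmbedding φ ∧
      (∀ x n i, φ x n i ∈ Set.Icc (0:ℝ) 1) ∧
      (∀ x, φ (T x) = shift (φ x)) := by
  let S := shiftHomeomorph (Fin l)
  have hπS : ∀ (n : ℤ) x, π ((T ^ n) x) = (S ^ n) (π x) :=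
    Homeomorph.map_zpow_of_semiconj hπe
  obtain ⟨f, hf⟩ := exists_continuousMap_orbit_separating T hπc (D := D) (by
    intro ε hε δ hδ f
    obtain ⟨ε', hε', hfε⟩ := Metric.uniformContinuous_iff.1
      (CompactSpace.uniformContinuous_of_continuous f.continuous) (δ / 2) (by positivity)
    obtain ⟨N, hN⟩ := eventually_exists_widimLE_dynDist hmdim (lt_min hε hε')
    obtain ⟨U, hU, hUs, hUc⟩ := exists_isClopen_marker S hZc.isCompact
      (fun z hz n hn => by
        rw [← Homeomorph.iterate_eq_zpow]
        exact hZap z hz n hn) N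
    obtain ⟨g, hgc, hg01, hgf, hgs⟩ := exists_perturbation_of_marker T hN (hU.preimage hπc)
      (fun x hx n hn hnN => by
        rw [mem_preimage, hπS]
        exact hUs _ hx n hn hnN)
      (fun x => by
        simp only [mem_preimage, hπS]
        exact hUc _ (hπr ▸ mem_range_self x))
      (half_pos hδ) (fun x i => (f x i : ℝ)) (fun x i => (f x i).2)
      (fun x y hxy i => (dist_le_pi_dist (f x) (f y) i).trans_lt
        (hfε (hxy.trans_le (min_le_right _ _))))
    refine ⟨⟨fun x i => ⟨g x i, hg01 x i⟩, by fun_prop⟩, ?_, fun x y hxy hn => ?_⟩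
    · refine (ContinuousMap.dist_le hδ.le).2 fun x => (dist_pi_le_iff hδ.le).2 fun i => ?_
      exact (hgf x i).trans_eq (mul_div_cancel₀ δ two_ne_zero)
    · refine (hgs x y (fun n => ?_) fun n => ?_).trans_le (min_le_left _ _)
      · simp only [mem_preimage, hπS, hxy]
      · ext i
        exact congrArg Subtype.val (congrFun (hn n) i))
  exact exists_equivariant_embedding_of_orbit_separating T hD hl hπc hπe f hf
end

section
/- Let D be a positive integer and (X,T) an extension of an aperiodic zero-dimensional system. If mdim(X,T) < D/2, then (X,T) embeds equivariantly into (([0,1]^{D+1})^ℤ, σ). -/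
open scoped ENNReal NNReal
open Set Function Filter Topology

/-- Finitely many points of a finite-dimensional normed space can be moved into general position
by an arbitrarily small perturbation. -/
theorem exists_generalPosition {ι E : Type*} [NormedAddCommGroup E] [NormedSpace ℝ E]
    [FiniteDimensional ℝ E] (q : ι → E) {η : ℝ} (hη : 0 < η) (s : Finset ι) :
    ∃ p : ι → E, (∀ i, dist (p i) (q i) < η) ∧
      ∀ t ⊆ s, t.card ≤ Module.finrank ℝ E + 1 → AffineIndependent ℝ (fun i : t => p i) := by
  classical
  induction s using Finset.induction_on with
  | empty =>
    refine ⟨q, fun i => by simpa using hη, fun t ht _ => ?_⟩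
    obtain rfl := Finset.subset_empty.1 ht
    exact affineIndependent_of_subsingleton ℝ _
  | insert a s ha ih =>
    obtain ⟨p, hpq, hp⟩ := ih
    obtain ⟨c, hc, hcs⟩ : ∃ c ∈ Metric.ball (q a) η, ∀ t ⊆ s, t.card ≤ Module.finrank ℝ E →
        c ∉ affineSpan ℝ (p '' t) := by
      by_contra! H
      let _ : MeasurableSpace E := borel E
      have : BorelSpace E := ⟨rfl⟩
      let μ : MeasureTheory.Measure E := MeasureTheory.Measure.addHaar
      have hsub : Metric.ball (q a) η ⊆
          ⋃ t ∈ s.powerset.filter (fun t => t.card ≤ Module.finrank ℝ E),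
            (affineSpan ℝ (p '' (t : Set ι)) : Set E) := by
        intro c hc
        obtain ⟨t, hts, htc, hct⟩ := H c hc
        simp only [Set.mem_iUnion]
        exact ⟨t, by simp [hts, htc], hct⟩
      have h0 : μ (⋃ t ∈ s.powerset.filter (fun t => t.card ≤ Module.finrank ℝ E),
            (affineSpan ℝ (p '' (t : Set ι)) : Set E)) = 0 := by
        rw [← Finset.set_biUnion_coe,
          MeasureTheory.measure_biUnion_null_iff (Finset.countable_toSet _)]
        intro t ht
        have htc : t.card ≤ Module.finrank ℝ E := by
          have := ht
          simp only [Finset.coe_filter, Set.mem_ofPred_eq] at this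
          exact this.2
        apply MeasureTheory.Measure.addHaar_affineSubspace
        intro htop
        have hne : (p '' (t : Set ι)).Nonempty := by
          rw [← affineSpan_nonempty ℝ, htop]
          exact ⟨0, trivial⟩
        have hcard : t.card = (t.card - 1) + 1 := by
          have : 0 < t.card := Finset.card_pos.2 (by simpa using hne)
          omega
        have h1 := finrank_vectorSpan_image_finset_le ℝ p t hcard
        rw [← direction_affineSpan, Finset.coe_image, htop, AffineSubspace.direction_top,
          finrank_top] at h1
        omega
      exact (Metric.measure_ball_pos μ (q a) hη).ne' (MeasureTheory.measure_mono_null hsub h0)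
    refine ⟨Function.update p a c, fun i => ?_, fun t ht htc => ?_⟩
    · by_cases hi : i = a
      · subst hi; simpa using hc
      · simpa [hi] using hpq i
    · by_cases hat : a ∈ t
      · have hsub : t.erase a ⊆ s := by
          intro i hi
          have := ht (Finset.mem_of_mem_erase hi)
          exact (Finset.mem_insert.1 this).resolve_left (Finset.ne_of_mem_erase hi)
        have hcd : (t.erase a).card + 1 = t.card := Finset.card_erase_add_one hat
        refine AffineIndependent.affineIndependent_of_notMem_span (i := ⟨a, hat⟩) ?_ ?_
        · have := hp (t.erase a) hsub (by omega)
          let e : {y : t // y ≠ ⟨a, hat⟩} ↪ (t.erase a : Finset ι) :=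
            ⟨fun y => ⟨y.1.1, Finset.mem_erase.2 ⟨fun h => y.2 (Subtype.ext h), y.1.2⟩⟩,
              fun y z h => Subtype.ext (Subtype.ext (by simpa using h))⟩
          have heq : (fun y : {y : t // y ≠ ⟨a, hat⟩} => Function.update p a c y) =
              (fun i : (t.erase a : Finset ι) => p i) ∘ e := by
            funext y
            have : (y.1 : ι) ≠ a := fun h => y.2 (Subtype.ext h)
            exact Function.update_of_ne this c p
          rw [heq]
          exact this.comp_embedding e
        · have := hcs (t.erase a) hsub (by omega)
          have heq : (fun i : t => Function.update p a c i) '' {y | y ≠ ⟨a, hat⟩} =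
              p '' (t.erase a : Finset ι) := ?_
          · rw [heq]
            simpa only [Function.update_self] using this
          ext v
          constructor
          · rintro ⟨y, hy, rfl⟩
            have hya : (y : ι) ≠ a := fun h => hy (Subtype.ext h)
            exact ⟨y, by simp [hya], by simp [hya]⟩
          · rintro ⟨y, hy, rfl⟩
            simp only [Finset.coe_erase, Set.mem_sdiff, Finset.mem_coe, Set.mem_singleton_iff] at hy
            exact ⟨⟨y, hy.1⟩, fun h => hy.2 (congrArg Subtype.val h), by simp [hy.2]⟩
      · have hsub : t ⊆ s := fun i hi =>
          (Finset.mem_insert.1 (ht hi)).resolve_left (fun h => hat (h ▸ hi))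
        have heq : (fun i : t => Function.update p a c i) = fun i : t => p i := by
          funext i
          have : (i : ι) ≠ a := fun h => hat (h ▸ i.2)
          simp [this]
        rw [heq]
        exact hp t hsub htc

/-- If the `ε`-width dimension is at most `k` and `2 k + 1 ≤ dim E`, then every sufficiently
uniformly continuous map to `E` can be approximated by a map with fibres of size `< ε`. -/
theorem WidimLE.exists_approx {X E : Type*} [TopologicalSpace X] [NormalSpace X]
    [ParacompactSpace X] [NormedAddCommGroup E] [NormedSpace ℝ E] [FiniteDimensional ℝ E]
    {ρ : X → X → ℝ} {ε : ℝ} {k : ℕ} (h : WidimLE ρ ε k) (hk : 2 * k < Module.finrank ℝ E)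
    (f : X → E) {η : ℝ} (hη : 0 < η) (hf : ∀ x y, ρ x y < ε → dist (f x) (f y) < η) :
    ∃ F : X → E, Continuous F ∧ (∀ x, dist (F x) (f x) ≤ 2 * η) ∧
      ∀ x y, F x = F y → ρ x y < ε := by
  classical
  obtain ⟨N, U, hUo, hUc, hUm, hUk⟩ := h
  obtain ⟨ϕ, hϕ⟩ := PartitionOfUnity.exists_isSubordinate isClosed_univ U hUo hUc.ge
  have hϕU : ∀ i x, ϕ i x ≠ 0 → x ∈ U i := fun i x hx =>
    hϕ i (subset_tsupport _ hx)
  have hsum : ∀ x, ∑ i, ϕ i x = 1 := fun x => by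
    rw [← finsum_eq_sum_of_fintype]; exact ϕ.sum_eq_one (Set.mem_univ x)
  have hq : ∀ i, ∃ q : E, ∀ x ∈ U i, dist q (f x) < η := fun i => by
    rcases (U i).eq_empty_or_nonempty with h | ⟨y, hy⟩
    · exact ⟨0, by simp [h]⟩
    · exact ⟨f y, fun x hx => hf _ _ (hUm i _ hy _ hx)⟩
  choose q hq using hq
  obtain ⟨p, hpq, hp⟩ := exists_generalPosition q hη Finset.univ
  refine ⟨fun x => ∑ i, ϕ i x • p i, ?_, fun x => ?_, fun x y hxy => ?_⟩
  · exact continuous_finsetSum _ fun i _ => (ϕ i).continuous.smul continuous_const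
  · have : ∑ i, ϕ i x • p i - f x = ∑ i, ϕ i x • (p i - f x) := by
      simp only [smul_sub, Finset.sum_sub_distrib, ← Finset.sum_smul, hsum, one_smul]
    rw [dist_eq_norm, this]
    calc ‖∑ i, ϕ i x • (p i - f x)‖ ≤ ∑ i, ϕ i x * (2 * η) := by
          refine norm_sum_le_of_le _ fun i _ => ?_
          rw [norm_smul, Real.norm_of_nonneg (ϕ.nonneg i x)]
          by_cases h0 : ϕ i x = 0
          · simp [h0]
          · refine mul_le_mul_of_nonneg_left ?_ (ϕ.nonneg i x)
            rw [← dist_eq_norm]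
            linarith [dist_triangle (p i) (q i) (f x), hpq i, hq i x (hϕU i x h0)]
      _ = 2 * η := by rw [← Finset.sum_mul, hsum, one_mul]
  · let A : X → Finset (Fin N) := fun z => Finset.univ.filter (fun i => z ∈ U i)
    have hA : ∀ z, (A z).card ≤ k + 1 := fun z => by
      have := hUk z
      rwa [Set.ncard_eq_toFinset_card', Set.toFinset_ofPred] at this
    have ht := hp (A x ∪ A y) (Finset.subset_univ _) (by
      have := Finset.card_union_le (A x) (A y)
      have := hA x
      have := hA y
      omega)
    have hzero : ∀ i ∉ A x ∪ A y, ϕ i x - ϕ i y = 0 := fun i hi => by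
      simp only [A, Finset.mem_union, Finset.mem_filter, Finset.mem_univ, true_and, not_or] at hi
      rw [of_not_not (mt (hϕU i x) hi.1), of_not_not (mt (hϕU i y) hi.2), sub_zero]
    have hw := (affineIndependent_iff.1 ht) Finset.univ (fun i => ϕ i x - ϕ i y) (by
      rw [Finset.sum_coe_sort (A x ∪ A y) (fun i => ϕ i x - ϕ i y),
        Finset.sum_subset (Finset.subset_univ _) (fun i _ hi => hzero i hi),
        Finset.sum_sub_distrib, hsum, hsum, sub_self]) (by
      rw [Finset.sum_coe_sort (A x ∪ A y) (fun i => (ϕ i x - ϕ i y) • p i),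
        Finset.sum_subset (Finset.subset_univ _) (fun i _ hi => by rw [hzero i hi, zero_smul])]
      simp only [sub_smul, Finset.sum_sub_distrib]
      exact sub_eq_zero.2 hxy)
    obtain ⟨i, hi⟩ : ∃ i, ϕ i x ≠ 0 := by
      by_contra! H
      have := hsum x
      simp [H] at this
    have hxi := hϕU i x hi
    have hyi : x ∈ U i ∧ y ∈ U i := by
      refine ⟨hxi, hϕU i y fun h0 => hi ?_⟩
      have := hw ⟨i, by simp [A, hxi]⟩ (Finset.mem_univ _)
      simpa [h0] using this
    exact hUm i x hyi.1 y hyi.2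

/-- A compact totally disconnected metrizable space embeds continuously into the real line. -/
theorem exists_continuous_injective_real (Z : Type*) [MetricSpace Z] [CompactSpace Z]
    [TotallyDisconnectedSpace Z] : ∃ e : Z → ℝ, Continuous e ∧ Function.Injective e := by
  classical
  have : Countable (TopologicalSpace.Clopens Z) :=
    TopologicalSpace.Clopens.countable_iff_secondCountable.2 inferInstance
  obtain ⟨U, hU⟩ := exists_surjective_nat (TopologicalSpace.Clopens Z)
  let c : Z → ℕ → Bool := fun z n => decide (z ∈ U n)
  have hc : Continuous c := by
    refine continuous_pi fun n => ?_
    refine (IsLocallyConstant.iff_exists_open _).2 (fun z => ?_) |>.continuous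
    by_cases hz : z ∈ U n
    · exact ⟨U n, (U n).isOpen, hz, fun y hy => by
        have : y ∈ U n := hy
        simp [c, hz, this]⟩
    · exact ⟨(U n : Set Z)ᶜ, (U n).isClosed.isOpen_compl, hz, fun y hy => by
        have : y ∉ U n := hy
        simp [c, hz, this]⟩
  refine ⟨fun z => (cantorSetHomeomorphNatToBool.symm (c z) : ℝ), by fun_prop, fun y z hyz => ?_⟩
  have hyz' : c y = c z := cantorSetHomeomorphNatToBool.symm.injective (Subtype.ext hyz)
  by_contra hne
  obtain ⟨V, hV, hy, hz⟩ := exists_isClopen_of_totally_separated hne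
  obtain ⟨n, hn⟩ := hU ⟨V, hV⟩
  have := congrFun hyz' n
  have h1 : y ∈ U n := hn ▸ hy
  have h2 : z ∉ U n := hn ▸ hz
  simp [c, h1, h2] at this

theorem Homeomorph.zpow_add_apply {X : Type*} [TopologicalSpace X] (T : X ≃ₜ X) (m n : ℤ)
    (x : X) : (T ^ (m + n)) x = (T ^ m) ((T ^ n) x) := by
  rw [zpow_add]; rfl

theorem Homeomorph.natCast_zpow_apply {X : Type*} [TopologicalSpace X] (T : X ≃ₜ X) (n : ℕ)
    (x : X) : (T ^ (n : ℤ)) x = (⇑T)^[n] x := by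
  induction n with
  | zero => rfl
  | succ n ih =>
    rw [Nat.cast_succ, add_comm, Homeomorph.zpow_add_apply, ih,
      Function.iterate_succ_apply', zpow_one]

theorem Homeomorph.zpow_apply_ne_self {Z : Type*} [TopologicalSpace Z] {S : Z ≃ₜ Z}
    (hap : ∀ (z : Z) (n : ℕ), 0 < n → (⇑S)^[n] z ≠ z) (z : Z) {i : ℤ} (hi : i ≠ 0) :
    (S ^ i) z ≠ z := by
  intro h
  rcases lt_or_gt_of_ne hi with h0 | h0
  · refine hap z i.natAbs (by omega) ?_
    rw [← Homeomorph.natCast_zpow_apply, show ((i.natAbs : ℕ) : ℤ) = -i by omega]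
    nth_rw 1 [← h]
    rw [← Homeomorph.zpow_add_apply]
    simp
  · refine hap z i.natAbs (by omega) ?_
    rwa [← Homeomorph.natCast_zpow_apply, show ((i.natAbs : ℕ) : ℤ) = i by omega]

theorem exists_clopen_nhds_separated {Z : Type*} [MetricSpace Z] [CompactSpace Z]
    [TotallyDisconnectedSpace Z] {S : Z ≃ₜ Z}
    (hap : ∀ (z : Z) (n : ℕ), 0 < n → (⇑S)^[n] z ≠ z) (N : ℕ) (z : Z) :
    ∃ V : Set Z, IsClopen V ∧ z ∈ V ∧
      ∀ y ∈ V, ∀ i : ℤ, |i| < N → i ≠ 0 → (S ^ i) y ∉ V := by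
  have hW : ∀ i : ℤ, ∃ V : Set Z, IsClopen V ∧ z ∈ V ∧ (i ≠ 0 → ∀ y ∈ V, (S ^ i) y ∉ V) := by
    intro i
    by_cases hi : i = 0
    · exact ⟨Set.univ, isClopen_univ, trivial, fun h => absurd hi h⟩
    · obtain ⟨W, hW, hz, hz'⟩ :=
        exists_isClopen_of_totally_separated (Homeomorph.zpow_apply_ne_self hap z hi).symm
      refine ⟨W ∩ (S ^ i) ⁻¹' Wᶜ, hW.inter (hW.compl.preimage (S ^ i).continuous), ⟨hz, hz'⟩,
        fun _ y hy hy' => hy.2 hy'.1⟩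
  choose V hV hzV hsep using hW
  refine ⟨⋂ i ∈ Finset.Ioo (-(N : ℤ)) N, V i, isClopen_biInter_finset fun i _ => hV i,
    Set.mem_iInter₂.2 fun i _ => hzV i, fun y hy i hi hi0 hy' => ?_⟩
  have hmem : i ∈ Finset.Ioo (-(N : ℤ)) N := by
    rw [Finset.mem_Ioo]; exact abs_lt.1 hi
  exact hsep i hi0 y (Set.mem_iInter₂.1 hy i hmem) (Set.mem_iInter₂.1 hy' i hmem)

/-- Clopen markers: an aperiodic zero-dimensional system has, for every `N`, a clopen set whose
return times are at least `N` and which every orbit visits with gaps less than `2 N`. -/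
theorem exists_clopen_marker {Z : Type*} [MetricSpace Z] [CompactSpace Z]
    [TotallyDisconnectedSpace Z] {S : Z ≃ₜ Z}
    (hap : ∀ (z : Z) (n : ℕ), 0 < n → (⇑S)^[n] z ≠ z) {N : ℕ} (hN : 0 < N) :
    ∃ U : Set Z, IsClopen U ∧ (∀ z ∈ U, ∀ i : ℤ, |i| < N → i ≠ 0 → (S ^ i) z ∉ U) ∧
      ∀ z, ∃ i : ℤ, |i| < N ∧ (S ^ i) z ∈ U := by
  classical
  choose V hV hzV hsep using exists_clopen_nhds_separated hap N
  have key : ∀ s : Finset Z, ∃ U : Set Z, IsClopen U ∧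
      (∀ z ∈ U, ∀ i : ℤ, |i| < N → i ≠ 0 → (S ^ i) z ∉ U) ∧
      ∀ y ∈ s, ∀ z ∈ V y, ∃ i : ℤ, |i| < N ∧ (S ^ i) z ∈ U := by
    intro s
    induction s using Finset.induction_on with
    | empty => exact ⟨∅, isClopen_empty, by simp, by simp⟩
    | insert a s _ ih =>
      obtain ⟨U, hU, hUs, hUc⟩ := ih
      let B : Set Z := ⋃ i ∈ Finset.Ioo (-(N : ℤ)) N, (S ^ i) ⁻¹' U
      have hB : IsClopen B := isClopen_biUnion_finset fun i _ => hU.preimage (S ^ i).continuous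
      have hBmem : ∀ z, z ∈ B ↔ ∃ i : ℤ, |i| < N ∧ (S ^ i) z ∈ U := by
        intro z
        simp [B, abs_lt]
      refine ⟨U ∪ (V a \ B), hU.union ((hV a).diff hB), ?_, ?_⟩
      · rintro z (hz | hz) i hi hi0 (hz' | hz')
        · exact hUs z hz i hi hi0 hz'
        · refine hz'.2 ((hBmem _).2 ⟨-i, by rwa [abs_neg], ?_⟩)
          rwa [← Homeomorph.zpow_add_apply, neg_add_cancel, zpow_zero]
        · exact hz.2 ((hBmem _).2 ⟨i, hi, hz'⟩)
        · exact hsep a z hz.1 i hi hi0 hz'.1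
      · intro y hy z hz
        by_cases hzB : z ∈ B
        · obtain ⟨i, hi, hiU⟩ := (hBmem z).1 hzB
          exact ⟨i, hi, Or.inl hiU⟩
        · rcases Finset.mem_insert.1 hy with rfl | hy
          · exact ⟨0, by simpa using hN, Or.inr ⟨hz, hzB⟩⟩
          · exact absurd ((hBmem z).2 (hUc y hy z hz)) hzB
  obtain ⟨s, hs⟩ := isCompact_univ.elim_finite_subcover V (fun z => (hV z).isOpen)
    (fun z _ => Set.mem_iUnion.2 ⟨z, hzV z⟩)
  obtain ⟨U, hU, hUs, hUc⟩ := key s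
  refine ⟨U, hU, hUs, fun z => ?_⟩
  obtain ⟨y, hy, hz⟩ := Set.mem_iUnion₂.1 (hs (Set.mem_univ z))
  exact hUc y hy z hz

/-- `IsBlock S U z n a`: the time `0` is at position `a` in a block of length `n` between two
consecutive visits of the `S`-orbit of `z` to `U`. -/
def IsBlock {Z : Type*} [TopologicalSpace Z] (S : Z ≃ₜ Z) (U : Set Z) (z : Z) (n a : ℕ) : Prop :=
  a < n ∧ (S ^ (-a : ℤ)) z ∈ U ∧ (S ^ (n - a : ℤ)) z ∈ U ∧
    ∀ i ∈ Finset.Ioo (-a : ℤ) (n - a), (S ^ i) z ∉ U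

namespace IsBlock

variable {Z : Type*} [TopologicalSpace Z] {S : Z ≃ₜ Z} {U : Set Z}

theorem unique {z : Z} {n a n' a' : ℕ} (h : IsBlock S U z n a) (h' : IsBlock S U z n' a') :
    n = n' ∧ a = a' := by
  obtain ⟨h1, h2, h3, h4⟩ := h
  obtain ⟨h1', h2', h3', h4'⟩ := h'
  have ha : a = a' := by
    by_contra hne
    rcases lt_or_gt_of_ne hne with hlt | hlt
    · exact h4' _ (by rw [Finset.mem_Ioo]; omega) h2
    · exact h4 _ (by rw [Finset.mem_Ioo]; omega) h2'
  subst ha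
  refine ⟨?_, rfl⟩
  by_contra hne
  rcases lt_or_gt_of_ne hne with hlt | hlt
  · exact h4' _ (by rw [Finset.mem_Ioo]; omega) h3
  · exact h4 _ (by rw [Finset.mem_Ioo]; omega) h3'

theorem isOpen_setOf (hU : IsClopen U) (n a : ℕ) : IsOpen {z | IsBlock S U z n a} := by
  by_cases hlt : a < n
  · have heq : {z | IsBlock S U z n a} =
        (S ^ (-a : ℤ)) ⁻¹' U ∩ ((S ^ (n - a : ℤ)) ⁻¹' U ∩
          ⋂ i ∈ Finset.Ioo (-a : ℤ) (n - a), (S ^ i) ⁻¹' Uᶜ) := by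
      ext z
      simp [IsBlock, hlt]
    rw [heq]
    exact (hU.preimage (S ^ _).continuous).isOpen.inter
      ((hU.preimage (S ^ _).continuous).isOpen.inter
        (isOpen_biInter_finset fun i _ => (hU.compl.preimage (S ^ i).continuous).isOpen))
  · have heq : {z | IsBlock S U z n a} = ∅ := by
      ext z
      simp [IsBlock, hlt]
    rw [heq]
    exact isOpen_empty

theorem move {z : Z} {n a : ℕ} (h : IsBlock S U z n a) {b : ℕ} (hb : b < n) :
    IsBlock S U ((S ^ (b - a : ℤ)) z) n b := by
  obtain ⟨h1, h2, h3, h4⟩ := h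
  refine ⟨hb, ?_, ?_, fun i hi => ?_⟩
  · rw [← Homeomorph.zpow_add_apply]
    convert h2 using 3
    ring
  · rw [← Homeomorph.zpow_add_apply]
    convert h3 using 3
    ring
  · rw [← Homeomorph.zpow_add_apply]
    rw [Finset.mem_Ioo] at hi
    exact h4 _ (by rw [Finset.mem_Ioo]; omega)

theorem exists_of_marker {N : ℕ} (hUs : ∀ z ∈ U, ∀ i : ℤ, |i| < N → i ≠ 0 → (S ^ i) z ∉ U)
    (hUc : ∀ z, ∃ i : ℤ, |i| < N ∧ (S ^ i) z ∈ U) (z : Z) :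
    ∃ n a, N ≤ n ∧ IsBlock S U z n a := by
  classical
  have hpast : ∃ a : ℕ, (S ^ (-a : ℤ)) z ∈ U := by
    obtain ⟨i, hi, hiU⟩ := hUc ((S ^ (-N : ℤ)) z)
    rw [← Homeomorph.zpow_add_apply] at hiU
    rw [abs_lt] at hi
    exact ⟨(N - i).toNat, by rwa [show (-((N - i).toNat : ℕ) : ℤ) = i + -N by omega]⟩
  have hfut : ∃ b : ℕ, 0 < b ∧ (S ^ (b : ℤ)) z ∈ U := by
    obtain ⟨i, hi, hiU⟩ := hUc ((S ^ (N : ℤ)) z)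
    rw [← Homeomorph.zpow_add_apply] at hiU
    rw [abs_lt] at hi
    exact ⟨(i + N).toNat, by omega, by rwa [show (((i + N).toNat : ℕ) : ℤ) = i + N by omega]⟩
  obtain ⟨ha, ha'⟩ := (⟨Nat.find_spec hpast, fun _ h => Nat.find_min hpast h⟩ :
    _ ∧ ∀ m < Nat.find hpast, _)
  obtain ⟨hb, hb'⟩ := (⟨Nat.find_spec hfut, fun _ h => Nat.find_min hfut h⟩ :
    _ ∧ ∀ m < Nat.find hfut, _)
  generalize Nat.find hpast = a at *
  generalize Nat.find hfut = b at *
  refine ⟨a + b, a, ?_, by omega, ha, ?_, fun i hi hiU => ?_⟩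
  · by_contra! hlt
    refine hUs _ ha (a + b : ℕ) (by rw [abs_lt]; omega) (by omega) ?_
    rw [← Homeomorph.zpow_add_apply]
    convert hb.2 using 3
    push_cast
    ring
  · convert hb.2 using 3
    push_cast
    ring
  · rw [Finset.mem_Ioo] at hi
    rcases le_or_gt i 0 with h0 | h0
    · refine ha' (-i).toNat (by omega) ?_
      rwa [show (-((-i).toNat : ℕ) : ℤ) = i by omega]
    · refine hb' i.toNat (by omega) ⟨by omega, ?_⟩
      rwa [show ((i.toNat : ℕ) : ℤ) = i by omega]

end IsBlock

theorem eventually_exists_widimLE_of_mdim_lt {X : Type*} [MetricSpace X] {T : X → X} {D : ℕ}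
    (h : mdim T < (D : ℝ≥0∞) / 2) {ε : ℝ} (hε : 0 < ε) :
    ∀ᶠ n : ℕ in atTop, ∃ k : ℕ, 2 * k < n * D ∧ WidimLE (dynDist T n) ε k := by
  have h1 : atTop.limsup (fun n : ℕ => widim (dynDist T n) ε / (n : ℝ≥0∞)) < (D : ℝ≥0∞) / 2 :=
    lt_of_le_of_lt (le_iSup₂ (f := fun (ε : ℝ) (_ : 0 < ε) =>
      atTop.limsup fun n : ℕ => widim (dynDist T n) ε / (n : ℝ≥0∞)) ε hε) h
  filter_upwards [Filter.eventually_lt_of_limsup_lt h1, eventually_gt_atTop 0] with n hn hn0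
  have hn0' : (n : ℝ≥0∞) ≠ 0 := by exact_mod_cast hn0.ne'
  rw [ENNReal.div_lt_iff (Or.inl hn0') (Or.inl (ENNReal.natCast_ne_top n)), widim,
    sInf_lt_iff] at hn
  obtain ⟨_, ⟨k, rfl, hk⟩, hlt⟩ := hn
  refine ⟨k, ?_, hk⟩
  have h2 : (2 : ℝ≥0∞) * k < 2 * ((D : ℝ≥0∞) / 2 * n) :=
    (ENNReal.mul_lt_mul_iff_right (by norm_num) (by norm_num)).2 hlt
  rw [← mul_assoc, ENNReal.mul_div_cancel (by norm_num) (by norm_num), mul_comm (D : ℝ≥0∞)] at h2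
  exact_mod_cast h2

theorem dynDist_lt_iff {X : Type*} [MetricSpace X] {T : X → X} {n : ℕ} {x y : X} {ε : ℝ}
    (hε : 0 < ε) : dynDist T n x y < ε ↔ ∀ i < n, dist (T^[i] x) (T^[i] y) < ε := by
  lift ε to ℝ≥0 using hε.le
  rw [dynDist, NNReal.coe_lt_coe, Finset.sup_lt_iff (by simpa using hε)]
  simp [← coe_nndist]

/-- The maps separating the points of the fibres of `π` along orbits up to scale `ε`. -/
def fibreSeparating {X Z E : Type*} [MetricSpace X] [TopologicalSpace E] (T : X ≃ₜ X) (π : X → Z)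
    (ε : ℝ) : Set C(X, E) :=
  {f | ∀ x y, π x = π y → (∀ n : ℤ, f ((T ^ n) x) = f ((T ^ n) y)) → dist x y < ε}

theorem isOpen_fibreSeparating {X Z E : Type*} [MetricSpace X] [CompactSpace X]
    [TopologicalSpace Z] [T2Space Z] [TopologicalSpace E] [T2Space E] (T : X ≃ₜ X) {π : X → Z}
    (hπ : Continuous π) (ε : ℝ) :
    IsOpen (fibreSeparating T π ε : Set C(X, E)) := by
  have hK : IsCompact {p : X × X | π p.1 = π p.2 ∧ ε ≤ dist p.1 p.2} := by
    refine IsClosed.isCompact (IsClosed.inter ?_ ?_)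
    · exact isClosed_eq (hπ.comp continuous_fst) (hπ.comp continuous_snd)
    · exact isClosed_le continuous_const continuous_dist
  rw [isOpen_iff_mem_nhds]
  intro f hf
  have := hK.eventually_forall_of_forall_eventually (x₀ := f)
    (P := fun g p => ∃ n : ℤ, g ((T ^ n) p.1) ≠ g ((T ^ n) p.2)) (by
      rintro p ⟨hp, hpε⟩
      obtain ⟨n, hn⟩ : ∃ n : ℤ, f ((T ^ n) p.1) ≠ f ((T ^ n) p.2) := by
        by_contra! H
        exact absurd (hf p.1 p.2 hp H) (not_lt.2 hpε)
      have hc1 : Continuous fun z : C(X, E) × (X × X) => z.1 ((T ^ n) z.2.1) := by fun_prop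
      have hc2 : Continuous fun z : C(X, E) × (X × X) => z.1 ((T ^ n) z.2.2) := by fun_prop
      filter_upwards [(isOpen_ne_fun hc1 hc2).mem_nhds (show (f, p) ∈ _ from hn)] with z hz
      exact ⟨n, hz⟩)
  filter_upwards [this] with g hg x y hxy hn
  by_contra! H
  obtain ⟨n, hn'⟩ := hg (x, y) ⟨hxy, H⟩
  exact hn' (hn n)

theorem dense_fibreSeparating {X Z : Type*} [MetricSpace X] [CompactSpace X]
    [MetricSpace Z] [CompactSpace Z] [TotallyDisconnectedSpace Z]
    {T : X ≃ₜ X} {S : Z ≃ₜ Z}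
    (hap : ∀ (z : Z) (n : ℕ), 0 < n → (⇑S)^[n] z ≠ z)
    {π : X → Z} (hπc : Continuous π) (hπ : ∀ (n : ℤ) x, π ((T ^ n) x) = (S ^ n) (π x))
    {D : ℕ} (hmdim : mdim ⇑T < (D : ℝ≥0∞) / 2) {ε : ℝ} (hε : 0 < ε) :
    Dense (fibreSeparating T π ε : Set C(X, Fin D → ℝ)) := by
  rw [Metric.dense_iff]
  intro f r hr
  obtain ⟨δ, hδ, hfδ⟩ := Metric.uniformContinuous_iff.1
    (CompactSpace.uniformContinuous_of_continuous f.continuous) (r / 5) (by positivity)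
  set ε' := min ε δ with hε'
  have hε'0 : 0 < ε' := lt_min hε hδ
  obtain ⟨N, hN⟩ := eventually_atTop.1 (eventually_exists_widimLE_of_mdim_lt hmdim hε'0)
  have hG : ∀ n, ∃ G : ℕ → X → (Fin D → ℝ), (∀ j, Continuous (G j)) ∧ (N ≤ n →
      (∀ j < n, ∀ x, dist (G j x) (f (T^[j] x)) ≤ 2 * (r / 5)) ∧
      ∀ x y, (∀ j < n, G j x = G j y) → ∀ j < n, dist (T^[j] x) (T^[j] y) < ε') := by
    intro n
    by_cases hn : N ≤ n
    swap
    · exact ⟨fun _ _ => 0, fun _ => continuous_const, fun h => absurd h hn⟩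
    obtain ⟨k, hk, hw⟩ := hN n hn
    obtain ⟨F, hFc, hFf, hF⟩ := hw.exists_approx (E := Fin n → Fin D → ℝ)
      (by simpa [Module.finrank_pi_fintype] using hk) (fun x j => f (T^[j] x))
      (η := r / 5) (by positivity) (fun x y hxy => by
        rw [dynDist_lt_iff hε'0] at hxy
        rw [dist_pi_lt_iff (by positivity)]
        exact fun j => hfδ (lt_of_lt_of_le (hxy j j.2) (min_le_right _ _)))
    refine ⟨fun j x => if h : j < n then F x ⟨j, h⟩ else 0, fun j => ?_, fun _ => ⟨?_, ?_⟩⟩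
    · by_cases h : j < n
      · simp only [h, dite_true]
        exact (continuous_apply (⟨j, h⟩ : Fin n)).comp hFc
      · simpa only [h, dite_false] using continuous_const
    · intro j hj x
      simp only [hj, dite_true]
      exact (dist_le_pi_dist (F x) _ ⟨j, hj⟩).trans (hFf x)
    · intro x y hxy
      rw [← dynDist_lt_iff hε'0]
      refine hF x y (funext fun j => ?_)
      simpa using hxy j j.2
  choose G hGc hG using hG
  obtain ⟨U, hU, hUs, hUc⟩ := exists_clopen_marker hap (Nat.succ_pos N)
  choose len pos hlen hblk using IsBlock.exists_of_marker hUs hUc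
  let g : X → Fin D → ℝ := fun x =>
    G (len (π x)) (pos (π x)) ((T ^ (-(pos (π x)) : ℤ)) x)
  have hgc : Continuous g := by
    rw [continuous_iff_continuousAt]
    intro x
    have hloc : ∀ᶠ y in 𝓝 x, G (len (π x)) (pos (π x)) ((T ^ (-(pos (π x)) : ℤ)) y) = g y := by
      filter_upwards [((IsBlock.isOpen_setOf hU (len (π x)) (pos (π x))).preimage hπc).mem_nhds
        (hblk (π x))] with y hy
      obtain ⟨h1, h2⟩ := IsBlock.unique hy (hblk (π y))
      simp only [g, h1, h2]
    exact ((hGc _ _).comp (T ^ _).continuous).continuousAt.congr hloc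
  refine ⟨⟨g, hgc⟩, ?_, ?_⟩
  · rw [Metric.mem_ball]
    refine lt_of_le_of_lt ((ContinuousMap.dist_le (by positivity)).2 fun x => ?_)
      (show 2 * (r / 5) < r by linarith)
    have := (hG (len (π x)) (by have := hlen (π x); omega)).1 (pos (π x)) (hblk (π x)).1
      ((T ^ (-(pos (π x)) : ℤ)) x)
    rwa [← Homeomorph.natCast_zpow_apply, ← Homeomorph.zpow_add_apply, add_neg_cancel,
      zpow_zero] at this
  · intro x y hxy hn
    have hb := hblk (π x)
    have key := (hG (len (π x)) (by have := hlen (π x); omega)).2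
      ((T ^ (-(pos (π x)) : ℤ)) x) ((T ^ (-(pos (π x)) : ℤ)) y) (fun j hj => by
        have hval : ∀ w, π w = π x → g ((T ^ (j - pos (π x) : ℤ)) w) =
            G (len (π x)) j ((T ^ (-(pos (π x)) : ℤ)) w) := by
          intro w hw
          have hm := hb.move hj
          rw [← hw, ← hπ, hw] at hm
          obtain ⟨h1, h2⟩ := hm.unique (hblk _)
          simp only [g]
          rw [← h1, ← h2, ← Homeomorph.zpow_add_apply]
          congr 3
          ring
        rw [← hval x rfl, ← hval y hxy.symm]
        exact hn _) (pos (π x)) hb.1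
    rw [← Homeomorph.natCast_zpow_apply, ← Homeomorph.natCast_zpow_apply,
      ← Homeomorph.zpow_add_apply, ← Homeomorph.zpow_add_apply, add_neg_cancel, zpow_zero] at key
    exact key.trans_le (min_le_left _ _)

/-- If `(X,T)` is an extension of an aperiodic zero-dimensional system and
`mdim(X,T) < D/2`, then `(X,T)` embeds equivariantly into the shift on
`([0,1]^{D+1})^ℤ`. -/
theorem stmt13 {X Z : Type*} [MetricSpace X] [CompactSpace X]
    [MetricSpace Z] [CompactSpace Z] [TotallyDisconnectedSpace Z]
    (T : X ≃ₜ X) (S : Z ≃ₜ Z)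
    (hap : ∀ (z : Z) (n : ℕ), 0 < n → (⇑S)^[n] z ≠ z)
    (π : X → Z) (hπc : Continuous π) (hπs : Function.Surjective π)
    (hπe : ∀ x, π (T x) = S (π x))
    (D : ℕ) (hD : 0 < D) (hmdim : mdim ⇑T < (D : ℝ≥0∞) / 2) :
    ∃ φ : X → ℤ → Fin (D + 1) → ℝ, Topology.IsEmbedding φ ∧
      (∀ x n i, φ x n i ∈ Set.Icc (0:ℝ) 1) ∧
      (∀ x, φ (T x) = shift (φ x)) := by
  have hπ : ∀ (n : ℤ) x, π ((T ^ n) x) = (S ^ n) (π x) := by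
    have hnat : ∀ (n : ℕ) x, π ((T ^ (n : ℤ)) x) = (S ^ (n : ℤ)) (π x) := fun n x => by
      rw [Homeomorph.natCast_zpow_apply, Homeomorph.natCast_zpow_apply]
      exact (Function.Semiconj.iterate_right hπe n) x
    intro n x
    rcases le_or_gt 0 n with h | h
    · lift n to ℕ using h
      exact hnat n x
    · have hn : ((-n).toNat : ℤ) = -n := by omega
      apply (S ^ (((-n).toNat : ℕ) : ℤ)).injective
      rw [← hnat, ← Homeomorph.zpow_add_apply, ← Homeomorph.zpow_add_apply, hn, neg_add_cancel,
        zpow_zero, zpow_zero]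
      rfl
  obtain ⟨f, hf⟩ := (dense_iInter_of_isOpen_nat
    (f := fun m : ℕ => (fibreSeparating T π (1 / ((m : ℝ) + 1)) : Set C(X, Fin D → ℝ)))
    (fun m => isOpen_fibreSeparating T hπc _)
    (fun m => dense_fibreSeparating hap hπc hπ hmdim (by positivity))).nonempty
  have hinj : ∀ x y, π x = π y → (∀ n : ℤ, f ((T ^ n) x) = f ((T ^ n) y)) → x = y := by
    intro x y hxy hn
    refine eq_of_forall_dist_le fun ε hε => ?_
    obtain ⟨m, hm⟩ := exists_nat_one_div_lt hε
    exact ((Set.mem_iInter.1 hf m x y hxy hn).trans hm).le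
  obtain ⟨e, hec, hei⟩ := exists_continuous_injective_real Z
  let c : ℝ → ℝ := fun t => (Real.arctan t + Real.pi / 2) / Real.pi
  have hcc : Continuous c := by fun_prop
  have hci : Function.Injective c := fun s t hst => by
    simpa [c, div_left_inj' Real.pi_ne_zero, Real.arctan_injective.eq_iff] using hst
  have hcI : ∀ t, c t ∈ Set.Icc (0 : ℝ) 1 := fun t => by
    have h1 := Real.neg_pi_div_two_lt_arctan t
    have h2 := Real.arctan_lt_pi_div_two t
    exact ⟨div_nonneg (by linarith) Real.pi_pos.le,
      (div_le_one Real.pi_pos).2 (by linarith)⟩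
  let φ : X → ℤ → Fin (D + 1) → ℝ := fun x n i =>
    c ((Fin.cons (e (π ((T ^ n) x))) (f ((T ^ n) x)) : Fin (D + 1) → ℝ) i)
  refine ⟨φ, (Continuous.isClosedEmbedding ?_ ?_).isEmbedding, fun x n i => hcI _, fun x => ?_⟩
  · refine continuous_pi fun n => continuous_pi fun i => hcc.comp ?_
    refine Fin.cases ?_ (fun j => ?_) i
    · simp only [Fin.cons_zero]
      exact hec.comp (hπc.comp (T ^ n).continuous)
    · simp only [Fin.cons_succ]
      exact (continuous_apply j).comp (f.continuous.comp (T ^ n).continuous)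
  · intro x y hxy
    have h : ∀ (n : ℤ) (i : Fin (D + 1)),
        (Fin.cons (e (π ((T ^ n) x))) (f ((T ^ n) x)) : Fin (D + 1) → ℝ) i =
        (Fin.cons (e (π ((T ^ n) y))) (f ((T ^ n) y)) : Fin (D + 1) → ℝ) i :=
      fun n i => hci (congrFun (congrFun hxy n) i)
    refine hinj x y (hei ?_) fun n => funext fun j => ?_
    · simpa using h 0 0
    · simpa using h n j.succ
  · funext n i
    simp only [φ, shift, Homeomorph.zpow_add_apply, zpow_one]
end
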